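/- arXiv:2406.12884 — 3 statements merged into one kernel-verified Lean document; each statement's English description precedes it below -/
import Mathlib

section
/- Let $K$ be any field and $n\geq 4$. Then every exponential automorphism of the free metabelian Lie algebra $M_n$ of lower degree $\geq 4$ is almost tame. -/
noncomputable section

/-- The free metabelian Lie algebra of rank `n` over `K`: the quotient of the free Lie
algebra on `n` generators by its second derived ideal. -/
abbrev FreeMetabelianLie (K : Type) [Field K] (n : ℕ) : Type :=
  FreeLieAlgebra K (Fin n) ⧸ LieAlgebra.derivedSeries K (FreeLieAlgebra K (Fin n)) 2

/-- The free generators `x₁, …, xₙ` of the free metabelian Lie algebra. -/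
def xg (K : Type) [Field K] (n : ℕ) (i : Fin n) : FreeMetabelianLie K n :=
  LieSubmodule.Quotient.mk (N := LieAlgebra.derivedSeries K (FreeLieAlgebra K (Fin n)) 2)
    (FreeLieAlgebra.of K i)

/-- The group structure on Lie algebra automorphisms, with `(e * f) x = e (f x)`. -/
instance lieAutGroup (K : Type) [CommRing K] (L : Type) [LieRing L] [LieAlgebra K L] :
    Group (L ≃ₗ⁅K⁆ L) where
  mul e f := f.trans e
  one := LieEquiv.refl
  inv := LieEquiv.symm
  mul_assoc _ _ _ := LieEquiv.ext fun _ => rfl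
  one_mul _ := LieEquiv.ext fun _ => rfl
  mul_one _ := LieEquiv.ext fun _ => rfl
  inv_mul_cancel e := LieEquiv.ext fun x => e.symm_apply_apply x

/-- An automorphism of the free metabelian Lie algebra is elementary if it maps some `xᵢ` to
`α • xᵢ + f`, with `0 ≠ α ∈ K` and `f` in the subalgebra generated by the other generators,
and fixes all other generators. -/
def IsElementaryAut (K : Type) [Field K] (n : ℕ)
    (φ : FreeMetabelianLie K n ≃ₗ⁅K⁆ FreeMetabelianLie K n) : Prop :=
  ∃ (i : Fin n) (α : K) (f : FreeMetabelianLie K n), α ≠ 0 ∧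
    f ∈ LieSubalgebra.lieSpan K (FreeMetabelianLie K n) (xg K n '' {j | j ≠ i}) ∧
    φ (xg K n i) = α • xg K n i + f ∧ ∀ j : Fin n, j ≠ i → φ (xg K n j) = xg K n j

/-- A tame automorphism is one in the subgroup generated by the elementary automorphisms. -/
def IsTame (K : Type) [Field K] (n : ℕ)
    (φ : FreeMetabelianLie K n ≃ₗ⁅K⁆ FreeMetabelianLie K n) : Prop :=
  φ ∈ Subgroup.closure {ψ | IsElementaryAut K n ψ}

/-- A Chein automorphism (one-row transformation) moves only one generator. -/
def IsCheinAut (K : Type) [Field K] (n : ℕ)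
    (φ : FreeMetabelianLie K n ≃ₗ⁅K⁆ FreeMetabelianLie K n) : Prop :=
  ∃ i : Fin n, ∀ j : Fin n, j ≠ i → φ (xg K n j) = xg K n j

/-- An almost tame automorphism is one in the subgroup generated by Chein automorphisms. -/
def IsAlmostTame (K : Type) [Field K] (n : ℕ)
    (φ : FreeMetabelianLie K n ≃ₗ⁅K⁆ FreeMetabelianLie K n) : Prop :=
  φ ∈ Subgroup.closure {ψ | IsCheinAut K n ψ}

/-- `monoSet K n k` is the set of right-normed Lie monomials of degree `k+1` in the
generators. -/
def monoSet (K : Type) [Field K] (n : ℕ) : ℕ → Set (FreeMetabelianLie K n)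
  | 0 => Set.range (xg K n)
  | k + 1 => {z | ∃ u ∈ monoSet K n k, ∃ i : Fin n, z = ⁅u, xg K n i⁆}

/-- `gradePiece K n k` (for `k ≥ 1`) is the homogeneous component `L_k` of the standard
grading: the linear span of the Lie monomials of degree `k` in the generators. -/
def gradePiece (K : Type) [Field K] (n : ℕ) (k : ℕ) : Submodule K (FreeMetabelianLie K n) :=
  Submodule.span K (monoSet K n (k - 1))

/-- The automorphism `φ = (l₁ + m₁, …, lₙ + mₙ)` (with `lᵢ` linear, `mᵢ ∈ [M,M]`) has lower
degree `≥ d`: each `φ(xᵢ)` lies in `L₁ ⊕ (⨆ k ≥ d, L_k)`. -/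
def AutLdegGE (K : Type) [Field K] (n : ℕ)
    (φ : FreeMetabelianLie K n ≃ₗ⁅K⁆ FreeMetabelianLie K n) (d : ℕ) : Prop :=
  ∀ i : Fin n, φ (xg K n i) ∈
    gradePiece K n 1 ⊔ ⨆ (k : ℕ) (_ : d ≤ k), gradePiece K n k

/-- The action of a polynomial `a ∈ U = K[y₁,…,yₙ]` on `m`; for `m ∈ [M,M]` this is the
canonical `U`-module action on the derived ideal, determined by `m ⬝ yᵢ = ⁅m, xᵢ⁆`. -/
def polyAct (K : Type) [Field K] (n : ℕ) (a : MvPolynomial (Fin n) K)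
    (m : FreeMetabelianLie K n) : FreeMetabelianLie K n :=
  ∑ d ∈ a.support, a.coeff d •
    ((List.ofFn fun i : Fin n =>
      (-(LieAlgebra.ad K (FreeMetabelianLie K n) (xg K n i))) ^ (d i)).prod m)

/-- The polynomial `a` has lower degree `≥ d`: every monomial of `a` has total degree `≥ d`. -/
def PolyLdegGE (K : Type) [Field K] (n : ℕ) (a : MvPolynomial (Fin n) K) (d : ℕ) : Prop :=
  ∀ v ∈ a.support, d ≤ ∑ i, v i

/-- An exponential automorphism: `exp (ad z) = id + ad z` for some `z ∈ [M,M]`. -/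
def IsExponentialAut (K : Type) [Field K] (n : ℕ)
    (φ : FreeMetabelianLie K n ≃ₗ⁅K⁆ FreeMetabelianLie K n) : Prop :=
  ∃ z ∈ LieAlgebra.derivedSeries K (FreeMetabelianLie K n) 1,
    ∀ m : FreeMetabelianLie K n, φ m = m + ⁅z, m⁆

end


noncomputable section

/-- The Lie algebra `K ⋉ K[X]`, where `1 ∈ K` acts on the abelian ideal `K[X]` as multiplication
by `-X`. -/
def ShiftLie (K : Type) [Field K] : Type := K × Polynomial K

namespace ShiftLie

variable {K : Type} [Field K]

instance : AddCommGroup (ShiftLie K) := inferInstanceAs (AddCommGroup (K × Polynomial K))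

instance : Module K (ShiftLie K) := inferInstanceAs (Module K (K × Polynomial K))

instance : Bracket (ShiftLie K) (ShiftLie K) :=
  ⟨fun u v => (0, Polynomial.X * (v.1 • u.2 - u.1 • v.2))⟩

theorem bracket_fst (u v : ShiftLie K) : ⁅u, v⁆.1 = 0 := rfl

theorem bracket_snd (u v : ShiftLie K) :
    ⁅u, v⁆.2 = Polynomial.X * (v.1 • u.2 - u.1 • v.2) := rfl

theorem add_fst (u v : ShiftLie K) : (u + v).1 = u.1 + v.1 := rfl

theorem add_snd (u v : ShiftLie K) : (u + v).2 = u.2 + v.2 := rfl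

theorem smul_fst (c : K) (u : ShiftLie K) : (c • u).1 = c • u.1 := rfl

theorem smul_snd (c : K) (u : ShiftLie K) : (c • u).2 = c • u.2 := rfl

theorem zero_snd : (0 : ShiftLie K).2 = 0 := rfl

@[ext]
theorem ext {u v : ShiftLie K} (h₁ : u.1 = v.1) (h₂ : u.2 = v.2) : u = v := Prod.ext h₁ h₂

instance : LieRing (ShiftLie K) where
  add_lie u v w := by
    ext1
    · simp [bracket_fst, add_fst]
    · simp only [bracket_snd, add_fst, add_snd, Polynomial.smul_eq_C_mul, map_add]; ring
  lie_add u v w := by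
    ext1
    · simp [bracket_fst, add_fst]
    · simp only [bracket_snd, add_fst, add_snd, Polynomial.smul_eq_C_mul, map_add]; ring
  lie_self u := by
    ext1
    · rfl
    · simp [bracket_snd, zero_snd]
  leibniz_lie u v w := by
    ext1
    · simp [bracket_fst, add_fst]
    · simp only [bracket_snd, bracket_fst, add_snd, Polynomial.smul_eq_C_mul, map_zero]; ring

instance : LieAlgebra K (ShiftLie K) where
  lie_smul c u v := by
    ext1
    · simp [bracket_fst, smul_fst]
    · simp only [bracket_snd, smul_fst, smul_snd, Polynomial.smul_eq_C_mul, smul_eq_mul, map_mul]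
      ring

/-- Projection to the ideal `K[X]`, followed by taking the coefficient of `X ^ d`. -/
def coeffSnd (d : ℕ) : ShiftLie K →ₗ[K] K where
  toFun u := u.2.coeff d
  map_add' u v := by rw [add_snd, Polynomial.coeff_add]
  map_smul' c u := by rw [smul_snd, Polynomial.coeff_smul]; rfl

theorem coeffSnd_apply (d : ℕ) (u : ShiftLie K) : coeffSnd d u = u.2.coeff d := rfl

end ShiftLie

namespace LieAlgebra

theorem mem_derivedSeries_one_iff {K L : Type*} [CommRing K] [LieRing L] [LieAlgebra K L] (u : L) :
    u ∈ derivedSeries K L 1 ↔ u ∈ Submodule.span K {z : L | ∃ a b : L, ⁅a, b⁆ = z} := by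
  rw [derivedSeries_def, derivedSeriesOfIdeal_succ, derivedSeriesOfIdeal_zero,
    ← LieSubmodule.mem_toSubmodule, LieSubmodule.lieIdeal_oper_eq_linear_span']
  simp

theorem lie_mem_derivedSeries_one (K : Type*) {L : Type*} [CommRing K] [LieRing L]
    [LieAlgebra K L] (a b : L) : ⁅a, b⁆ ∈ derivedSeries K L 1 :=
  (mem_derivedSeries_one_iff _).2 (Submodule.subset_span ⟨a, b, rfl⟩)

theorem derivedSeries_two_eq_bot_iff {K L : Type*} [CommRing K] [LieRing L] [LieAlgebra K L] :
    derivedSeries K L 2 = ⊥ ↔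
      ∀ u ∈ derivedSeries K L 1, ∀ v ∈ derivedSeries K L 1, ⁅u, v⁆ = 0 := by
  rw [derivedSeries_def, derivedSeriesOfIdeal_succ, LieSubmodule.lie_eq_bot_iff]

theorem derivedSeries_two_eq_bot_of_lie_lie {K L : Type*} [CommRing K] [LieRing L]
    [LieAlgebra K L] (h : ∀ a b c d : L, ⁅⁅a, b⁆, ⁅c, d⁆⁆ = 0) : derivedSeries K L 2 = ⊥ := by
  rw [derivedSeries_two_eq_bot_iff]
  intro u hu v hv
  rw [mem_derivedSeries_one_iff] at hu hv
  induction hu using Submodule.span_induction with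
  | zero => exact zero_lie _
  | add a b _ _ ha hb => rw [add_lie, ha, hb, add_zero]
  | smul c a _ ha => rw [smul_lie, ha, smul_zero]
  | mem a ha =>
    obtain ⟨a, b, rfl⟩ := ha
    induction hv using Submodule.span_induction with
    | zero => exact lie_zero _
    | add c d _ _ hc hd => rw [lie_add, hc, hd, add_zero]
    | smul r c _ hc => rw [lie_smul, hc, smul_zero]
    | mem c hc => obtain ⟨c, d, rfl⟩ := hc; exact h a b c d

end LieAlgebra

theorem ShiftLie.derivedSeries_two (K : Type) [Field K] :
    LieAlgebra.derivedSeries K (ShiftLie K) 2 = ⊥ :=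
  LieAlgebra.derivedSeries_two_eq_bot_of_lie_lie fun a b c d => by
    ext1
    · rfl
    · rw [ShiftLie.bracket_snd]; simp [ShiftLie.bracket_fst, ShiftLie.zero_snd]

namespace FreeMetabelianLie

open LieAlgebra

variable {K : Type} [Field K] {n : ℕ}

local notation "𝓜" => FreeMetabelianLie K n
local notation "𝔵" => xg K n
local notation "𝓓" => derivedSeries K (FreeMetabelianLie K n) 1

/-- The quotient map from the free Lie algebra onto the free metabelian Lie algebra. -/
def mkHom (K : Type) [Field K] (n : ℕ) :
    FreeLieAlgebra K (Fin n) →ₗ⁅K⁆ FreeMetabelianLie K n where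
  toLinearMap := (LieSubmodule.Quotient.mk'
    (derivedSeries K (FreeLieAlgebra K (Fin n)) 2)).toLinearMap
  map_lie' := rfl

theorem mkHom_surjective : Function.Surjective (mkHom K n) :=
  LieSubmodule.Quotient.surjective_mk' _

theorem mkHom_of (i : Fin n) : mkHom K n (FreeLieAlgebra.of K i) = 𝔵 i := rfl

theorem derivedSeries_two : derivedSeries K 𝓜 2 = ⊥ := by
  rw [← LieIdeal.derivedSeries_map_eq 2 (mkHom_surjective (K := K) (n := n)),
    LieIdeal.map_eq_bot_iff]
  intro u hu
  rw [LieHom.mem_ker]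
  exact (LieSubmodule.Quotient.mk_eq_zero _).2 hu

theorem lie_eq_zero {u v : 𝓜} (hu : u ∈ 𝓓) (hv : v ∈ 𝓓) : ⁅u, v⁆ = 0 :=
  derivedSeries_two_eq_bot_iff.1 derivedSeries_two u hu v hv

theorem hom_ext {L : Type*} [LieRing L] [LieAlgebra K L] {f g : 𝓜 →ₗ⁅K⁆ L}
    (h : ∀ i, f (𝔵 i) = g (𝔵 i)) : f = g := by
  have hfg : f.comp (mkHom K n) = g.comp (mkHom K n) := FreeLieAlgebra.hom_ext h
  ext m
  obtain ⟨u, rfl⟩ := mkHom_surjective m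
  exact LieHom.congr_fun hfg u

theorem equiv_ext {f g : 𝓜 ≃ₗ⁅K⁆ 𝓜} (h : ∀ i, f (𝔵 i) = g (𝔵 i)) : f = g :=
  LieEquiv.ext fun m => LieHom.congr_fun (hom_ext (f := f.toLieHom) (g := g.toLieHom) h) m

theorem subalgebra_eq_top (S : LieSubalgebra K 𝓜) (h : ∀ i, 𝔵 i ∈ S) (m : 𝓜) : m ∈ S := by
  obtain ⟨u, rfl⟩ := mkHom_surjective m
  have : mkHom K n = S.incl.comp (FreeLieAlgebra.lift K fun i => (⟨𝔵 i, h i⟩ : S)) :=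
    FreeLieAlgebra.hom_ext fun i => by simp [mkHom_of]
  rw [this]
  exact (FreeLieAlgebra.lift K (fun i => (⟨𝔵 i, h i⟩ : S)) u).2

theorem exists_hom {L : Type*} [LieRing L] [LieAlgebra K L] (hL : derivedSeries K L 2 = ⊥)
    (f : Fin n → L) : ∃ h : 𝓜 →ₗ⁅K⁆ L, ∀ i, h (𝔵 i) = f i := by
  have hker : derivedSeries K (FreeLieAlgebra K (Fin n)) 2 ≤ (FreeLieAlgebra.lift K f).ker := by
    rw [← LieIdeal.map_eq_bot_iff, eq_bot_iff, ← hL]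
    exact LieIdeal.derivedSeries_map_le 2
  let F : 𝓜 →ₗ[K] L := Submodule.liftQ _ (FreeLieAlgebra.lift K f).toLinearMap hker
  have hF (u) : F (mkHom K n u) = FreeLieAlgebra.lift K f u := rfl
  refine ⟨{ F with map_lie' := ?_ }, fun i => FreeLieAlgebra.lift_of_apply f i⟩
  intro u v
  obtain ⟨u, rfl⟩ := mkHom_surjective u
  obtain ⟨v, rfl⟩ := mkHom_surjective v
  change F ⁅_, _⁆ = ⁅F _, F _⁆
  rw [← LieHom.map_lie, hF, hF, hF, LieHom.map_lie]

/-- The associative algebra of operators on `𝓜` generated by the `ad xᵢ`. -/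
def adAlg (K : Type) [Field K] (n : ℕ) : Subalgebra K (Module.End K (FreeMetabelianLie K n)) :=
  Algebra.adjoin K (Set.range fun i => ad K (FreeMetabelianLie K n) (xg K n i))

theorem ad_mem_adAlg (i : Fin n) : ad K 𝓜 (𝔵 i) ∈ adAlg K n :=
  Algebra.subset_adjoin ⟨i, rfl⟩

theorem adAlg_mem_D {T : Module.End K 𝓜} (hT : T ∈ adAlg K n) {u : 𝓜} (hu : u ∈ 𝓓) :
    T u ∈ 𝓓 := by
  induction hT using Algebra.adjoin_induction generalizing u with
  | mem T hT => obtain ⟨i, rfl⟩ := hT; exact lie_mem_derivedSeries_one K (𝔵 i) u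
  | algebraMap r => exact (𝓓).smul_mem r hu
  | add S T _ _ hS hT => exact (𝓓).add_mem (hS hu) (hT hu)
  | mul S T _ _ hS hT => exact hS (hT hu)

/-- On the derived ideal, the operators `ad xᵢ` commute. -/
theorem adAlg_lie {T : Module.End K 𝓜} (hT : T ∈ adAlg K n) {u : 𝓜} (hu : u ∈ 𝓓) (m : 𝓜) :
    T ⁅u, m⁆ = ⁅T u, m⁆ := by
  induction hT using Algebra.adjoin_induction generalizing u with
  | mem T hT =>
    obtain ⟨i, rfl⟩ := hT
    rw [ad_apply, ad_apply, leibniz_lie, lie_eq_zero hu (lie_mem_derivedSeries_one K _ _),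
      add_zero]
  | algebraMap r => simp [Algebra.algebraMap_eq_smul_one]
  | add S T _ _ hS hT => rw [LinearMap.add_apply, LinearMap.add_apply, hS hu, hT hu, add_lie]
  | mul S T _ hTm hS hT =>
    rw [Module.End.mul_apply, Module.End.mul_apply, hT hu, hS (adAlg_mem_D hTm hu)]

theorem map_mem_D (f : 𝓜 →ₗ⁅K⁆ 𝓜) {u : 𝓜} (hu : u ∈ 𝓓) : f u ∈ 𝓓 := by
  rw [mem_derivedSeries_one_iff] at hu
  induction hu using Submodule.span_induction with
  | zero => simp
  | add a b _ _ ha hb => rw [map_add]; exact (𝓓).add_mem ha hb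
  | smul c a _ ha => rw [map_smul]; exact (𝓓).smul_mem c ha
  | mem a ha =>
    obtain ⟨a, b, rfl⟩ := ha
    rw [LieHom.map_lie]
    exact lie_mem_derivedSeries_one K _ _

/-- An endomorphism that is trivial modulo the derived ideal commutes on the derived ideal with
the operators `ad xᵢ`. -/
theorem map_adAlg {f : 𝓜 →ₗ⁅K⁆ 𝓜} (hf : ∀ i, f (𝔵 i) - 𝔵 i ∈ 𝓓) {T : Module.End K 𝓜}
    (hT : T ∈ adAlg K n) {u : 𝓜} (hu : u ∈ 𝓓) : f (T u) = T (f u) := by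
  induction hT using Algebra.adjoin_induction generalizing u with
  | mem T hT =>
    obtain ⟨i, rfl⟩ := hT
    have := lie_eq_zero (hf i) (map_mem_D f hu)
    rw [sub_lie, sub_eq_zero] at this
    rw [ad_apply, ad_apply, LieHom.map_lie, this]
  | algebraMap r => simp [Algebra.algebraMap_eq_smul_one]
  | add S T _ _ hS hT => rw [LinearMap.add_apply, LinearMap.add_apply, map_add, hS hu, hT hu]
  | mul S T _ hTm hS hT =>
    rw [Module.End.mul_apply, Module.End.mul_apply, hS (adAlg_mem_D hTm hu), hT hu]

theorem almostTame_mul {φ ψ : 𝓜 ≃ₗ⁅K⁆ 𝓜} (hφ : IsAlmostTame K n φ) (hψ : IsAlmostTame K n ψ) :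
    IsAlmostTame K n (φ * ψ) :=
  Subgroup.mul_mem _ hφ hψ

theorem almostTame_inv {φ : 𝓜 ≃ₗ⁅K⁆ 𝓜} (hφ : IsAlmostTame K n φ) : IsAlmostTame K n φ⁻¹ :=
  Subgroup.inv_mem _ hφ

theorem almostTame_one : IsAlmostTame K n 1 :=
  Subgroup.one_mem _

theorem mul_apply (φ ψ : 𝓜 ≃ₗ⁅K⁆ 𝓜) (m : 𝓜) : (φ * ψ) m = φ (ψ m) := rfl

theorem inv_apply_self (φ : 𝓜 ≃ₗ⁅K⁆ 𝓜) (m : 𝓜) : φ (φ⁻¹ m) = m := φ.apply_symm_apply m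

/-- The Chein automorphism `xᵢ ↦ xᵢ + u`, given that the two endomorphisms `xᵢ ↦ xᵢ ± u` fixing
the other generators fix `u`. -/
theorem exists_chein_of_fixed (i : Fin n) (u : 𝓜)
    (h : ∀ (f : 𝓜 →ₗ⁅K⁆ 𝓜) (c : K), f (𝔵 i) = 𝔵 i + c • u → (∀ j ≠ i, f (𝔵 j) = 𝔵 j) → f u = u) :
    ∃ φ : 𝓜 ≃ₗ⁅K⁆ 𝓜, IsAlmostTame K n φ ∧ φ (𝔵 i) = 𝔵 i + u ∧ ∀ j ≠ i, φ (𝔵 j) = 𝔵 j := by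
  have key (c : K) : ∃ f : 𝓜 →ₗ⁅K⁆ 𝓜, f (𝔵 i) = 𝔵 i + c • u ∧ ∀ j ≠ i, f (𝔵 j) = 𝔵 j := by
    obtain ⟨f, hf⟩ := exists_hom (derivedSeries_two (K := K) (n := n))
      (Function.update (xg K n) i (𝔵 i + c • u))
    exact ⟨f, by simp [hf], fun j hj => by simp [hf, hj]⟩
  obtain ⟨f, hfi, hf⟩ := key 1
  obtain ⟨g, hgi, hg⟩ := key (-1)
  have hfu := h f 1 hfi hf
  have hgu := h g (-1) hgi hg
  have hfg : f.comp g = LieHom.id := hom_ext fun j => by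
    by_cases hj : j = i
    · subst hj; simp [hgi, hfi, hfu]
    · simp [hg j hj, hf j hj]
  have hgf : g.comp f = LieHom.id := hom_ext fun j => by
    by_cases hj : j = i
    · subst hj; simp [hgi, hfi, hgu]
    · simp [hg j hj, hf j hj]
  refine ⟨{ f with
    invFun := g
    left_inv := LieHom.congr_fun hgf
    right_inv := LieHom.congr_fun hfg }, Subgroup.subset_closure ⟨i, hf⟩, ?_, hf⟩
  exact hfi.trans (by rw [one_smul])

/-- For `u` in the `adAlg K n`-module generated by `⁅xₐ, x_b⁆`, with `a, b ≠ i`, the Chein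
automorphism `xᵢ ↦ xᵢ + u`. -/
theorem exists_chein {i a b : Fin n} (ha : a ≠ i) (hb : b ≠ i) {T : Module.End K 𝓜}
    (hT : T ∈ adAlg K n) :
    ∃ φ : 𝓜 ≃ₗ⁅K⁆ 𝓜, IsAlmostTame K n φ ∧ φ (𝔵 i) = 𝔵 i + T ⁅𝔵 a, 𝔵 b⁆ ∧
      ∀ j ≠ i, φ (𝔵 j) = 𝔵 j := by
  refine exists_chein_of_fixed i _ fun f c hfi hf => ?_
  have hab := lie_mem_derivedSeries_one K (𝔵 a) (𝔵 b)
  rw [map_adAlg _ hT hab, LieHom.map_lie, hf a ha, hf b hb]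
  intro j
  by_cases hj : j = i
  · subst hj
    rw [hfi, add_sub_cancel_left]
    exact (𝓓).smul_mem c (adAlg_mem_D hT hab)
  · rw [hf j hj, sub_self]
    exact (𝓓).zero_mem

theorem lie_eq_adAlg {T : Module.End K 𝓜} (u : 𝓜) (k : Fin n) :
    ⁅T u, 𝔵 k⁆ = (-(ad K 𝓜 (𝔵 k) * T)) u := by
  rw [LinearMap.neg_apply, Module.End.mul_apply, ad_apply, lie_skew]

theorem neg_ad_mul_mem_adAlg {T : Module.End K 𝓜} (hT : T ∈ adAlg K n) (k : Fin n) :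
    -(ad K 𝓜 (𝔵 k) * T) ∈ adAlg K n :=
  neg_mem (mul_mem (ad_mem_adAlg k) hT)

/-- The part of `exp (ad z)` on the generators `xₖ`, `k ∈ S`, for `z` in the module generated by
`⁅xₐ, x_b⁆` with `a, b ∉ S`. -/
theorem exists_partial_exp (S : Finset (Fin n)) {a b : Fin n} (ha : a ∉ S) (hb : b ∉ S)
    {T : Module.End K 𝓜} (hT : T ∈ adAlg K n) :
    ∃ φ : 𝓜 ≃ₗ⁅K⁆ 𝓜, IsAlmostTame K n φ ∧
      (∀ k ∈ S, φ (𝔵 k) = 𝔵 k + ⁅T ⁅𝔵 a, 𝔵 b⁆, 𝔵 k⁆) ∧ ∀ k ∉ S, φ (𝔵 k) = 𝔵 k := by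
  have hab := lie_mem_derivedSeries_one K (𝔵 a) (𝔵 b)
  induction S using Finset.induction_on with
  | empty => exact ⟨1, almostTame_one, by simp, fun _ _ => rfl⟩
  | insert i S hi ih =>
    rw [Finset.mem_insert, not_or] at ha hb
    obtain ⟨φ, hφ, hφS, hφ'⟩ := ih ha.2 hb.2
    obtain ⟨ψ, hψ, hψi, hψ'⟩ := exists_chein ha.1 hb.1 (neg_ad_mul_mem_adAlg hT i)
    rw [← lie_eq_adAlg] at hψi
    have hφD (j : Fin n) : φ.toLieHom (𝔵 j) - 𝔵 j ∈ 𝓓 := by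
      by_cases hj : j ∈ S
      · rw [LieEquiv.coe_toLieHom, hφS j hj, add_sub_cancel_left]
        exact lie_mem_derivedSeries_one K _ _
      · rw [LieEquiv.coe_toLieHom, hφ' j hj, sub_self]
        exact (𝓓).zero_mem
    have hφz : φ (T ⁅𝔵 a, 𝔵 b⁆) = T ⁅𝔵 a, 𝔵 b⁆ := by
      refine (map_adAlg hφD hT hab).trans ?_
      rw [LieEquiv.coe_toLieHom, LieEquiv.map_lie, hφ' a ha.2, hφ' b hb.2]
    refine ⟨φ * ψ, almostTame_mul hφ hψ, fun k hk => ?_, fun k hk => ?_⟩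
    · rw [mul_apply]
      by_cases hki : k = i
      · subst hki
        rw [hψi, map_add, LieEquiv.map_lie, hφz, hφ' k hi]
      · rw [hψ' k hki, hφS k (Finset.mem_of_mem_insert_of_ne hk hki)]
    · rw [Finset.mem_insert, not_or] at hk
      rw [mul_apply, hψ' k hk.1, hφ' k hk.2]

/-- The exponential automorphism `exp (ad z)`. -/
theorem exists_exp {z : 𝓜} (hz : z ∈ 𝓓) : ∃ ψ : 𝓜 ≃ₗ⁅K⁆ 𝓜, ∀ m, ψ m = m + ⁅z, m⁆ := by
  have hzz (m : 𝓜) : ⁅z, ⁅z, m⁆⁆ = 0 := lie_eq_zero hz (lie_mem_derivedSeries_one K _ _)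
  refine ⟨{ (LinearMap.id + ad K 𝓜 z : 𝓜 →ₗ[K] 𝓜) with
    invFun := fun m => m - ⁅z, m⁆
    left_inv := ?_
    right_inv := ?_
    map_lie' := ?_ }, fun m => rfl⟩
  · intro u v
    change ⁅u, v⁆ + ⁅z, ⁅u, v⁆⁆ = ⁅u + ⁅z, u⁆, v + ⁅z, v⁆⁆
    rw [lie_add, add_lie, add_lie, leibniz_lie,
      lie_eq_zero (lie_mem_derivedSeries_one K z u) (lie_mem_derivedSeries_one K z v)]
    abel
  · intro m
    change m + ⁅z, m⁆ - ⁅z, m + ⁅z, m⁆⁆ = m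
    rw [lie_add, hzz]; abel
  · intro m
    change m - ⁅z, m⁆ + ⁅z, m - ⁅z, m⁆⁆ = m
    rw [lie_sub, hzz]; abel

/-- `exp (ad z)` is almost tame. -/
def HasAlmostTameExp (z : 𝓜) : Prop :=
  z ∈ 𝓓 ∧ ∃ ψ : 𝓜 ≃ₗ⁅K⁆ 𝓜, IsAlmostTame K n ψ ∧ ∀ m, ψ m = m + ⁅z, m⁆

theorem HasAlmostTameExp.zero : HasAlmostTameExp (0 : 𝓜) :=
  ⟨(𝓓).zero_mem, 1, almostTame_one, fun m => by rw [zero_lie, add_zero]; rfl⟩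

theorem HasAlmostTameExp.add {z w : 𝓜} (hz : HasAlmostTameExp z) (hw : HasAlmostTameExp w) :
    HasAlmostTameExp (z + w) := by
  obtain ⟨hz, φ, hφ, hφz⟩ := hz
  obtain ⟨hw, ψ, hψ, hψw⟩ := hw
  refine ⟨(𝓓).add_mem hz hw, φ * ψ, almostTame_mul hφ hψ, fun m => ?_⟩
  rw [mul_apply, hψw, hφz, lie_add, lie_eq_zero hz (lie_mem_derivedSeries_one K w m), add_lie]
  abel

theorem HasAlmostTameExp.neg {z : 𝓜} (hz : HasAlmostTameExp z) : HasAlmostTameExp (-z) := by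
  obtain ⟨hz, φ, hφ, hφz⟩ := hz
  refine ⟨(𝓓).neg_mem hz, φ⁻¹, almostTame_inv hφ, fun m => φ.injective ?_⟩
  change φ _ = φ _
  rw [inv_apply_self, hφz, lie_add, neg_lie, lie_neg,
    lie_eq_zero hz (lie_mem_derivedSeries_one K z m)]
  abel

theorem HasAlmostTameExp.map {z : 𝓜} (hz : HasAlmostTameExp z) {φ : 𝓜 ≃ₗ⁅K⁆ 𝓜}
    (hφ : IsAlmostTame K n φ) : HasAlmostTameExp (φ z) := by
  obtain ⟨hz, ψ, hψ, hψz⟩ := hz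
  refine ⟨map_mem_D φ.toLieHom hz, φ * ψ * φ⁻¹,
    almostTame_mul (almostTame_mul hφ hψ) (almostTame_inv hφ), fun m => ?_⟩
  rw [mul_apply, mul_apply, hψz, map_add, LieEquiv.map_lie, inv_apply_self]

/-- `exp (ad ⁅T ⁅xᵢ, xⱼ⁆, xₗ⁆)` is, up to Chein automorphisms, the commutator of
`xₘ ↦ xₘ + T ⁅xᵢ, xⱼ⁆` and the restriction of `exp (ad ⁅xₘ, xₗ⁆)` to `xᵢ` and `xⱼ`. -/
theorem hasAlmostTameExp_of_ne {i j l m : Fin n} (hli : l ≠ i) (hlj : l ≠ j) (hmi : m ≠ i)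
    (hmj : m ≠ j) (hml : m ≠ l) {T : Module.End K 𝓜} (hT : T ∈ adAlg K n) :
    HasAlmostTameExp ⁅T ⁅𝔵 i, 𝔵 j⁆, 𝔵 l⁆ := by
  have hp := lie_mem_derivedSeries_one K (𝔵 i) (𝔵 j)
  have hq := lie_mem_derivedSeries_one K (𝔵 m) (𝔵 l)
  have hTp := adAlg_mem_D hT hp
  have hz := lie_mem_derivedSeries_one K (T ⁅𝔵 i, 𝔵 j⁆) (𝔵 l)
  have hT' := neg_ad_mul_mem_adAlg hT l
  obtain ⟨A, hA, hAij, hA'⟩ := exists_partial_exp (K := K) {i, j} (a := m) (b := l)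
    (by simp [hmi, hmj]) (by simp [hli, hlj]) (one_mem _)
  obtain ⟨B, hB, hBm, hB'⟩ := exists_chein hmi.symm hmj.symm hT
  obtain ⟨E, hE, hE', hEij⟩ := exists_partial_exp ({i, j}ᶜ : Finset (Fin n)) (a := i) (b := j)
    (by simp) (by simp) hT'
  rw [← lie_eq_adAlg] at hE'
  rw [Module.End.one_apply] at hAij
  obtain ⟨χ, hχ⟩ := exists_exp hq
  obtain ⟨ψ, hψ⟩ := exists_exp hz
  have hAD (k : Fin n) : A.toLieHom (𝔵 k) - 𝔵 k ∈ 𝓓 := by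
    rw [LieEquiv.coe_toLieHom]
    by_cases hk : k ∈ ({i, j} : Finset (Fin n))
    · rw [hAij k hk, add_sub_cancel_left]
      exact lie_mem_derivedSeries_one K _ _
    · rw [hA' k hk, sub_self]
      exact (𝓓).zero_mem
  have hBD (k : Fin n) : B.toLieHom (𝔵 k) - 𝔵 k ∈ 𝓓 := by
    rw [LieEquiv.coe_toLieHom]
    by_cases hk : k = m
    · rw [hk, hBm, add_sub_cancel_left]
      exact hTp
    · rw [hB' k hk, sub_self]
      exact (𝓓).zero_mem
  have hAp : A ⁅𝔵 i, 𝔵 j⁆ = ⁅𝔵 i, 𝔵 j⁆ := by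
    rw [LieEquiv.map_lie, hAij i (by simp), hAij j (by simp), ← hχ, ← hχ, ← LieEquiv.map_lie, hχ,
      lie_eq_zero hq hp, add_zero]
  have hBp : B ⁅𝔵 i, 𝔵 j⁆ = ⁅𝔵 i, 𝔵 j⁆ := by
    rw [LieEquiv.map_lie, hB' i hmi.symm, hB' j hmj.symm]
  have hATp : A (T ⁅𝔵 i, 𝔵 j⁆) = T ⁅𝔵 i, 𝔵 j⁆ := (map_adAlg hAD hT hp).trans (congrArg T hAp)
  have hBTp : B (T ⁅𝔵 i, 𝔵 j⁆) = T ⁅𝔵 i, 𝔵 j⁆ := (map_adAlg hBD hT hp).trans (congrArg T hBp)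
  have hAz : A ⁅T ⁅𝔵 i, 𝔵 j⁆, 𝔵 l⁆ = ⁅T ⁅𝔵 i, 𝔵 j⁆, 𝔵 l⁆ := by
    rw [LieEquiv.map_lie, hATp, hA' l (by simp [hli, hlj])]
  have hBz : B ⁅T ⁅𝔵 i, 𝔵 j⁆, 𝔵 l⁆ = ⁅T ⁅𝔵 i, 𝔵 j⁆, 𝔵 l⁆ := by
    rw [LieEquiv.map_lie, hBTp, hB' l hml.symm]
  have hBq : B ⁅𝔵 m, 𝔵 l⁆ = ⁅𝔵 m, 𝔵 l⁆ + ⁅T ⁅𝔵 i, 𝔵 j⁆, 𝔵 l⁆ := by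
    rw [LieEquiv.map_lie, hBm, hB' l hml.symm, add_lie]
  have heq : ψ * (A * B) = B * A * E := by
    refine equiv_ext fun k => ?_
    simp only [mul_apply]
    by_cases hk : k ∈ ({i, j} : Finset (Fin n))
    · have hkm : k ≠ m := by rintro rfl; simp [hmi, hmj] at hk
      rw [hB' k hkm, hAij k hk, hψ, hEij k (by rwa [Finset.mem_compl, not_not]), hAij k hk, map_add,
        LieEquiv.map_lie, hBq, hB' k hkm, lie_add,
        lie_eq_zero hz (lie_mem_derivedSeries_one K _ _), add_lie]
      abel
    · rw [hE' k (Finset.mem_compl.2 hk), map_add, LieEquiv.map_lie, hAz, hA' k hk, map_add,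
        LieEquiv.map_lie, hBz]
      by_cases hkm : k = m
      · rw [hkm, hBm, map_add, hATp, hA' m (hkm ▸ hk), hψ]
      · rw [hB' k hkm, hA' k hk, hψ]
  refine ⟨hz, ψ, ?_, hψ⟩
  rw [eq_mul_inv_of_mul_eq heq]
  exact almostTame_mul (almostTame_mul (almostTame_mul hB hA) hE)
    (almostTame_inv (almostTame_mul hA hB))

/-- Conjugation by an automorphism that acts linearly on the generators preserves the operator
algebra `adAlg`. -/
theorem exists_adAlg_conj {φ : 𝓜 ≃ₗ⁅K⁆ 𝓜}
    (hφ : ∀ i, φ.symm (𝔵 i) ∈ Submodule.span K (Set.range (xg K n))) {T : Module.End K 𝓜}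
    (hT : T ∈ adAlg K n) : ∃ T' ∈ adAlg K n, ∀ m, φ (T' m) = T (φ m) := by
  induction hT using Algebra.adjoin_induction with
  | mem T hT =>
    obtain ⟨i, rfl⟩ := hT
    refine ⟨ad K 𝓜 (φ.symm (𝔵 i)), ?_, fun m => ?_⟩
    · have hi := hφ i
      generalize φ.symm (𝔵 i) = v at hi ⊢
      induction hi using Submodule.span_induction with
      | zero => rw [map_zero]; exact zero_mem _
      | add u v _ _ hu hv => rw [map_add]; exact add_mem hu hv
      | smul c u _ hu => rw [map_smul]; exact Subalgebra.smul_mem _ hu c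
      | mem u hu => obtain ⟨k, rfl⟩ := hu; exact ad_mem_adAlg k
    · rw [ad_apply, LieEquiv.map_lie, LieEquiv.apply_symm_apply, ad_apply]
  | algebraMap r =>
    exact ⟨algebraMap K _ r, Subalgebra.algebraMap_mem _ r, fun m => by
      simp [Algebra.algebraMap_eq_smul_one]⟩
  | add S T _ _ hS hT =>
    obtain ⟨S', hS', hS⟩ := hS
    obtain ⟨T', hT', hT⟩ := hT
    exact ⟨S' + T', add_mem hS' hT', fun m => by simp [hS, hT]⟩
  | mul S T _ _ hS hT =>
    obtain ⟨S', hS', hS⟩ := hS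
    obtain ⟨T', hT', hT⟩ := hT
    exact ⟨S' * T', mul_mem hS' hT', fun m => by simp [hS, hT]⟩

/-- The transvection `xₗ ↦ xₗ + xᵢ`. -/
theorem exists_transvection {i l : Fin n} (hil : i ≠ l) :
    ∃ φ : 𝓜 ≃ₗ⁅K⁆ 𝓜, IsAlmostTame K n φ ∧ φ (𝔵 l) = 𝔵 l + 𝔵 i ∧ ∀ j ≠ l, φ (𝔵 j) = 𝔵 j :=
  exists_chein_of_fixed l (𝔵 i) fun _ _ _ hf => hf i hil

theorem exists_ne_of_four_le (hn : 4 ≤ n) (a b c : Fin n) :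
    ∃ d : Fin n, d ≠ a ∧ d ≠ b ∧ d ≠ c := by
  obtain ⟨d, hd⟩ : ∃ d, d ∉ ({a, b, c} : Finset (Fin n)) := by
    by_contra! h
    have := Finset.card_le_three (a := a) (b := b) (c := c)
    rw [Finset.eq_univ_iff_forall.2 h, Finset.card_fin] at this
    omega
  simp only [Finset.mem_insert, Finset.mem_singleton, not_or] at hd
  exact ⟨d, hd⟩

theorem hasAlmostTameExp_of_eq (hn : 4 ≤ n) {i j : Fin n} {T : Module.End K 𝓜}
    (hT : T ∈ adAlg K n) : HasAlmostTameExp (T ⁅⁅𝔵 i, 𝔵 j⁆, 𝔵 i⁆) := by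
  obtain ⟨l, hli, hlj, -⟩ := exists_ne_of_four_le hn i j j
  obtain ⟨m, hmi, hmj, hml⟩ := exists_ne_of_four_le hn i j l
  have key {S : Module.End K 𝓜} (hS : S ∈ adAlg K n) :
      HasAlmostTameExp (S ⁅⁅𝔵 i, 𝔵 j⁆, 𝔵 l⁆) := by
    rw [adAlg_lie hS (lie_mem_derivedSeries_one K _ _)]
    exact hasAlmostTameExp_of_ne hli hlj hmi hmj hml hS
  obtain ⟨φ, hφ, hφl, hφ'⟩ := exists_transvection (K := K) hli.symm
  have hsymm (k : Fin n) : φ.symm (𝔵 k) ∈ Submodule.span K (Set.range (xg K n)) := by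
    have hk (k : Fin n) : 𝔵 k ∈ Submodule.span K (Set.range (xg K n)) :=
      Submodule.subset_span ⟨k, rfl⟩
    by_cases hkl : k = l
    · have : φ.symm (𝔵 l) = 𝔵 l - 𝔵 i := φ.injective <| by
        change φ _ = φ _
        rw [LieEquiv.apply_symm_apply, map_sub, hφl, hφ' i hli.symm, add_sub_cancel_right]
      rw [hkl, this]
      exact sub_mem (hk l) (hk i)
    · have : φ.symm (𝔵 k) = 𝔵 k := φ.injective <| by
        change φ _ = φ _
        rw [LieEquiv.apply_symm_apply, hφ' k hkl]
      rw [this]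
      exact hk k
  obtain ⟨S, hS, hST⟩ := exists_adAlg_conj hsymm hT
  have h := ((key hS).map hφ).add (key hT).neg
  rwa [hST, LieEquiv.map_lie, LieEquiv.map_lie, hφl, hφ' i hli.symm, hφ' j hlj.symm, lie_add,
    map_add, add_comm (T _), add_neg_cancel_right] at h

theorem hasAlmostTameExp_lie_lie (hn : 4 ≤ n) (i j l : Fin n) {T : Module.End K 𝓜}
    (hT : T ∈ adAlg K n) : HasAlmostTameExp (T ⁅⁅𝔵 i, 𝔵 j⁆, 𝔵 l⁆) := by
  by_cases hli : l = i
  · rw [hli]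
    exact hasAlmostTameExp_of_eq hn hT
  by_cases hlj : l = j
  · rw [hlj, ← lie_skew (𝔵 i), neg_lie, map_neg]
    exact (hasAlmostTameExp_of_eq hn hT).neg
  obtain ⟨m, hmi, hmj, hml⟩ := exists_ne_of_four_le hn i j l
  rw [adAlg_lie hT (lie_mem_derivedSeries_one K _ _)]
  exact hasAlmostTameExp_of_ne hli hlj hmi hmj hml hT

/-- The elements `z` of the derived ideal such that `exp (ad (T z))` is almost tame for every
`T ∈ adAlg K n`. -/
def stablyTame (K : Type) [Field K] (n : ℕ) : Submodule K (FreeMetabelianLie K n) where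
  carrier := {z | ∀ T ∈ adAlg K n, HasAlmostTameExp (T z)}
  zero_mem' T _ := by rw [map_zero]; exact HasAlmostTameExp.zero
  add_mem' hz hw T hT := by rw [map_add]; exact (hz T hT).add (hw T hT)
  smul_mem' c z hz T hT := by
    rw [T.map_smul c z]
    exact hz (c • T) (Subalgebra.smul_mem _ hT c)

theorem hasAlmostTameExp_of_mem {z : 𝓜} (hz : z ∈ stablyTame K n) : HasAlmostTameExp z :=
  hz 1 (one_mem _)

theorem gradePiece_le_stablyTame (hn : 4 ≤ n) {k : ℕ} (hk : 3 ≤ k) :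
    gradePiece K n k ≤ stablyTame K n := by
  obtain ⟨k, rfl⟩ := Nat.exists_eq_add_of_le' hk
  rw [gradePiece, Submodule.span_le]
  change monoSet K n (k + 2) ⊆ _
  induction k with
  | zero =>
    rintro _ ⟨_, ⟨_, ⟨i, rfl⟩, j, rfl⟩, l, rfl⟩ T hT
    exact hasAlmostTameExp_lie_lie hn i j l hT
  | succ k ih =>
    rintro _ ⟨u, hu, l, rfl⟩ T hT
    rw [← lie_skew, map_neg, ← ad_apply K, ← Module.End.mul_apply]
    exact (ih (by omega) hu _ (mul_mem hT (ad_mem_adAlg l))).neg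

/-- The span of the `⁅xᵢ, xⱼ⁆`, `i < j`. -/
def pairSpan (K : Type) [Field K] (n : ℕ) : Submodule K (FreeMetabelianLie K n) :=
  Submodule.span K (Set.range fun p : {p : Fin n × Fin n // p.1 < p.2} =>
    ⁅xg K n p.1.1, xg K n p.1.2⁆)

/-- The sum of the homogeneous components of degree at least `d`. -/
def gradeGE (K : Type) [Field K] (n d : ℕ) : Submodule K (FreeMetabelianLie K n) :=
  ⨆ (k : ℕ) (_ : d ≤ k), gradePiece K n k

theorem lie_mem_pairSpan (i j : Fin n) : ⁅𝔵 i, 𝔵 j⁆ ∈ pairSpan K n := by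
  rcases lt_trichotomy i j with h | rfl | h
  · exact Submodule.subset_span ⟨⟨(i, j), h⟩, rfl⟩
  · rw [lie_self]; exact zero_mem _
  · rw [← lie_skew]
    exact neg_mem (Submodule.subset_span ⟨⟨(j, i), h⟩, rfl⟩)

theorem gradePiece_le_gradeGE {d k : ℕ} (h : d ≤ k) : gradePiece K n k ≤ gradeGE K n d :=
  le_iSup₂_of_le k h le_rfl

theorem lie_mem_gradeGE {d : ℕ} (hd : 1 ≤ d) {u : 𝓜} (hu : u ∈ gradeGE K n d) (i : Fin n) :
    ⁅u, 𝔵 i⁆ ∈ gradeGE K n (d + 1) := by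
  have : gradeGE K n d ≤ (gradeGE K n (d + 1)).comap (ad K 𝓜 (𝔵 i)) := by
    refine iSup₂_le fun k hk => ?_
    rw [gradePiece, Submodule.span_le]
    intro u hu
    obtain ⟨k, rfl⟩ := Nat.exists_eq_add_of_le' (hd.trans hk)
    rw [SetLike.mem_coe, Submodule.mem_comap, ad_apply, ← lie_skew]
    exact neg_mem (gradePiece_le_gradeGE (k := k + 2) (by omega)
      (Submodule.subset_span ⟨u, hu, i, rfl⟩))
  rw [← lie_skew]
  exact neg_mem (this hu)

theorem mem_pairSpan_sup_gradeGE {z : 𝓜} (hz : z ∈ 𝓓) : z ∈ pairSpan K n ⊔ gradeGE K n 3 := by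
  set Q := pairSpan K n ⊔ gradeGE K n 3 with hQ
  set W := Submodule.span K (Set.range (xg K n)) ⊔ Q with hW
  have hQW : Q ≤ W := le_sup_right
  have hx (i : Fin n) : W ≤ Q.comap (ad K 𝓜 (𝔵 i)) := by
    refine sup_le ?_ (sup_le ?_ ?_)
    · rw [Submodule.span_le]
      rintro _ ⟨j, rfl⟩
      exact le_sup_left (a := pairSpan K n) (lie_mem_pairSpan i j)
    · rw [pairSpan, Submodule.span_le]
      rintro _ ⟨⟨⟨j, k⟩, -⟩, rfl⟩
      rw [SetLike.mem_coe, Submodule.mem_comap, ad_apply, ← lie_skew]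
      exact neg_mem (le_sup_right (a := pairSpan K n) (gradePiece_le_gradeGE le_rfl
        (Submodule.subset_span ⟨_, ⟨_, ⟨j, rfl⟩, k, rfl⟩, i, rfl⟩)))
    · intro u hu
      rw [Submodule.mem_comap, ad_apply, ← lie_skew]
      have h4 : gradeGE K n 4 ≤ gradeGE K n 3 :=
        iSup₂_le fun k hk => gradePiece_le_gradeGE (by omega)
      exact neg_mem (le_sup_right (a := pairSpan K n) (h4 (lie_mem_gradeGE (by omega) hu i)))
  let N : LieSubalgebra K 𝓜 :=
    { carrier := {m | ∀ w ∈ W, ⁅m, w⁆ ∈ Q}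
      zero_mem' := fun w _ => by rw [zero_lie]; exact zero_mem _
      add_mem' := fun ha hb w hw => by rw [add_lie]; exact add_mem (ha w hw) (hb w hw)
      smul_mem' := fun c a ha w hw => by rw [smul_lie]; exact Submodule.smul_mem _ c (ha w hw)
      lie_mem' := fun {a b} ha hb w hw => by
        rw [lie_lie]
        exact sub_mem (ha _ (hQW (hb w hw))) (hb _ (hQW (ha w hw))) }
  have hN (m : 𝓜) : ∀ w ∈ W, ⁅m, w⁆ ∈ Q := subalgebra_eq_top N (fun i => hx i) m
  let W' : LieSubalgebra K 𝓜 := { W with lie_mem' := fun {a b} _ hb => hQW (hN a b hb) }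
  have hW' (m : 𝓜) : m ∈ W :=
    subalgebra_eq_top W' (fun i => le_sup_left (b := Q) (Submodule.subset_span ⟨i, rfl⟩)) m
  rw [mem_derivedSeries_one_iff] at hz
  refine Submodule.span_le.2 ?_ hz
  rintro _ ⟨a, b, rfl⟩
  exact hN a b (hW' b)

/-- A homomorphism to `K ⋉ K[X]` mapping the generators to `K ⋉ K` maps monomials of degree
`k + 1` to multiples of `X ^ k`, modulo the first factor if `k = 0`. -/
theorem shift_of_mem_monoSet {h : 𝓜 →ₗ⁅K⁆ ShiftLie K}
    (hh : ∀ i, ∃ r : K, (h (𝔵 i)).2 = Polynomial.C r) {k : ℕ} {u : 𝓜} (hu : u ∈ monoSet K n k) :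
    (1 ≤ k → (h u).1 = 0) ∧ ∃ r : K, (h u).2 = Polynomial.monomial k r := by
  induction k generalizing u with
  | zero => obtain ⟨i, rfl⟩ := hu; exact ⟨by simp, hh i⟩
  | succ k ih =>
    obtain ⟨v, hv, i, rfl⟩ := hu
    obtain ⟨hv0, r, hr⟩ := ih hv
    obtain ⟨s, hs⟩ := hh i
    rw [LieHom.map_lie]
    refine ⟨fun _ => ShiftLie.bracket_fst _ _, ?_⟩
    rw [ShiftLie.bracket_snd, hr, hs]
    rcases Nat.eq_zero_or_pos k with rfl | hk
    · refine ⟨(h (𝔵 i)).1 * r - (h v).1 * s, ?_⟩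
      rw [← Polynomial.C_mul_X_pow_eq_monomial, ← Polynomial.C_mul_X_pow_eq_monomial]
      simp only [Polynomial.smul_eq_C_mul, map_sub, map_mul]
      ring
    · refine ⟨(h (𝔵 i)).1 * r, ?_⟩
      rw [hv0 hk, ← Polynomial.C_mul_X_pow_eq_monomial, ← Polynomial.C_mul_X_pow_eq_monomial]
      simp only [Polynomial.smul_eq_C_mul, map_mul, map_zero]
      ring

theorem coeffSnd_eq_zero_of_mem_gradePiece {h : 𝓜 →ₗ⁅K⁆ ShiftLie K}
    (hh : ∀ i, ∃ r : K, (h (𝔵 i)).2 = Polynomial.C r) {k d : ℕ} (hkd : k - 1 ≠ d) :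
    gradePiece K n k ≤ LinearMap.ker (ShiftLie.coeffSnd d ∘ₗ h.toLinearMap) := by
  rw [gradePiece, Submodule.span_le]
  intro u hu
  obtain ⟨-, r, hr⟩ := shift_of_mem_monoSet hh hu
  change (h u).2.coeff d = 0
  rw [hr, Polynomial.coeff_monomial, if_neg hkd]

theorem coeffSnd_eq_zero_of_mem_gradeGE {h : 𝓜 →ₗ⁅K⁆ ShiftLie K}
    (hh : ∀ i, ∃ r : K, (h (𝔵 i)).2 = Polynomial.C r) {k d : ℕ} (hkd : d + 1 < k) :
    gradeGE K n k ≤ LinearMap.ker (ShiftLie.coeffSnd d ∘ₗ h.toLinearMap) :=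
  iSup₂_le fun k' hk' => coeffSnd_eq_zero_of_mem_gradePiece hh (by omega)

/-- If `exp (ad z)` has lower degree at least `4`, then `z` has lower degree at least `3`. -/
theorem mem_gradeGE_three {z : 𝓜} (hz : z ∈ 𝓓)
    (hdeg : ∀ i, 𝔵 i + ⁅z, 𝔵 i⁆ ∈ gradePiece K n 1 ⊔ gradeGE K n 4) : z ∈ gradeGE K n 3 := by
  obtain ⟨z₂, hz₂, z₃, hz₃, rfl⟩ := Submodule.mem_sup.1 (mem_pairSpan_sup_gradeGE hz)
  obtain ⟨c, rfl⟩ := (Submodule.mem_span_range_iff_exists_fun K).1 hz₂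
  suffices hc : c = 0 by simpa [hc] using hz₃
  funext ⟨⟨i, j⟩, hij⟩
  change i < j at hij
  obtain ⟨h, hgen⟩ := exists_hom (ShiftLie.derivedSeries_two K)
    (fun k : Fin n => ((if k = j then 1 else 0, if k = i then 1 else 0) : ShiftLie K))
  have hfst (k : Fin n) : (h (𝔵 k)).1 = if k = j then 1 else 0 := by rw [hgen]
  have hsnd (k : Fin n) : (h (𝔵 k)).2 = if k = i then 1 else 0 := by rw [hgen]
  have hh (k : Fin n) : ∃ r : K, (h (𝔵 k)).2 = Polynomial.C r := by
    by_cases hk : k = i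
    · exact ⟨1, by rw [hsnd, if_pos hk, map_one]⟩
    · exact ⟨0, by rw [hsnd, if_neg hk, map_zero]⟩
  have hpair (k l : Fin n) : ShiftLie.coeffSnd 1 (h ⁅𝔵 k, 𝔵 l⁆) =
      (if l = j ∧ k = i then 1 else 0) - (if k = j ∧ l = i then 1 else 0) := by
    rw [LieHom.map_lie, ShiftLie.coeffSnd_apply, ShiftLie.bracket_snd, hfst, hfst, hsnd, hsnd,
      Polynomial.coeff_X_mul]
    simp only [Polynomial.coeff_sub, Polynomial.coeff_smul, smul_eq_mul, apply_ite
      (fun p : Polynomial K => p.coeff 0), Polynomial.coeff_one_zero, Polynomial.coeff_zero,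
      ite_zero_mul_ite_zero, mul_one]
  have hz₃' : (h z₃).2.coeff 1 = 0 := coeffSnd_eq_zero_of_mem_gradeGE hh (by omega) hz₃
  have h2 : (h (𝔵 j + ⁅_, 𝔵 j⁆)).2.coeff 2 = 0 := sup_le
    (coeffSnd_eq_zero_of_mem_gradePiece hh (by omega))
    (coeffSnd_eq_zero_of_mem_gradeGE hh (by omega)) (hdeg j)
  rw [map_add, LieHom.map_lie, ShiftLie.add_snd, ShiftLie.bracket_snd, hsnd j, hfst j,
    if_neg hij.ne', if_pos rfl, zero_add, smul_zero, sub_zero, one_smul, Polynomial.coeff_X_mul,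
    map_add, ShiftLie.add_snd, Polynomial.coeff_add, hz₃', add_zero,
    ← ShiftLie.coeffSnd_apply, map_sum, map_sum, Finset.sum_eq_single ⟨(i, j), hij⟩] at h2
  · simpa only [map_smul, hpair, and_self, hij.ne, false_and, if_true, if_false, sub_zero,
      smul_eq_mul, mul_one, Pi.zero_apply] using h2
  · rintro ⟨⟨k, l⟩, hkl⟩ - hne
    change k < l at hkl
    have h1 : ¬(l = j ∧ k = i) := fun ⟨hl, hk⟩ => hne (by subst hk hl; rfl)
    have h2 : ¬(k = j ∧ l = i) := fun ⟨hk, hl⟩ => by subst hk hl; exact absurd hij hkl.asymm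
    rw [map_smul, map_smul, hpair, if_neg h1, if_neg h2, sub_zero, smul_zero]
  · simp

end FreeMetabelianLie

end

/-- **Corollary 2.** Over any field `K`, for `n ≥ 4`, every exponential automorphism of the
free metabelian Lie algebra `Mₙ` of lower degree `≥ 4` is almost tame. -/
theorem exponential_aut_ldeg_ge_four_is_almost_tame (K : Type) [Field K] (n : ℕ) (hn : 4 ≤ n)
    (φ : FreeMetabelianLie K n ≃ₗ⁅K⁆ FreeMetabelianLie K n)
    (hexp : IsExponentialAut K n φ) (hdeg : AutLdegGE K n φ 4) :
    IsAlmostTame K n φ := by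
  obtain ⟨z, hz, hφ⟩ := hexp
  have hz₃ : z ∈ FreeMetabelianLie.gradeGE K n 3 :=
    FreeMetabelianLie.mem_gradeGE_three hz fun i => hφ (xg K n i) ▸ hdeg i
  obtain ⟨-, ψ, hψ, hψz⟩ := FreeMetabelianLie.hasAlmostTameExp_of_mem
    (iSup₂_le (fun _ => FreeMetabelianLie.gradePiece_le_stablyTame hn) hz₃)
  rwa [show φ = ψ from LieEquiv.ext fun m => by rw [hφ, hψz]]
end

section
/- Let $K$ be a field, $n\geq 2$, and $a=(a_1,\ldots,a_n)^t\in U^n$ a column over $U=K[y_1,\ldots,y_n]$. The following conditions are equivalent: (a) $a=\partial(f):=(\partial f/\partial x_1,\ldots,\partial f/\partial x_n)^t$ for some $f\in[M_n,M_n]$; (b) $y_1a_1+\cdots+y_na_n=0$; (c) $a=\sum_{1\leq i<j\leq n}(e_iy_j-e_jy_i)a_{ij}$ for some $a_{ij}\in U$, where $e_1,\ldots,e_n$ are the standard basis columns. -/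
noncomputable section

/-- The Magnus model `M = Yₙ ⊕ Tₙ` of the wreath product: `Yₙ = K y₁ ⊕ ⋯ ⊕ K yₙ` and `Tₙ`
the free `U`-module with basis `t₁, …, tₙ`, `U = K[y₁,…,yₙ]`. -/
structure Mag (K : Type) [Field K] (n : ℕ) where
  /-- the component in `Yₙ` -/
  y : Fin n → K
  /-- the coordinates in `Tₙ`: `t = t₁ d₁ + ⋯ + tₙ dₙ` -/
  t : Fin n → MvPolynomial (Fin n) K

namespace Mag

variable {K : Type} [Field K] {n : ℕ}

@[ext] theorem ext' {p q : Mag K n} (h1 : p.y = q.y) (h2 : p.t = q.t) : p = q := by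
  cases p; cases q; cases h1; cases h2; rfl

instance : Zero (Mag K n) := ⟨⟨0, 0⟩⟩
instance : Add (Mag K n) := ⟨fun p q => ⟨p.y + q.y, p.t + q.t⟩⟩
instance : Neg (Mag K n) := ⟨fun p => ⟨-p.y, -p.t⟩⟩
instance : SMul K (Mag K n) := ⟨fun c p => ⟨c • p.y, c • p.t⟩⟩

@[simp] lemma zero_y : (0 : Mag K n).y = 0 := rfl
@[simp] lemma zero_t : (0 : Mag K n).t = 0 := rfl
@[simp] lemma add_y (p q : Mag K n) : (p + q).y = p.y + q.y := rfl
@[simp] lemma add_t (p q : Mag K n) : (p + q).t = p.t + q.t := rfl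
@[simp] lemma neg_y (p : Mag K n) : (-p).y = -p.y := rfl
@[simp] lemma neg_t (p : Mag K n) : (-p).t = -p.t := rfl
@[simp] lemma smul_y (c : K) (p : Mag K n) : (c • p).y = c • p.y := rfl
@[simp] lemma smul_t (c : K) (p : Mag K n) : (c • p).t = c • p.t := rfl

instance : AddCommGroup (Mag K n) where
  add_assoc p q r := by ext1 <;> simp [add_assoc]
  zero_add p := by ext1 <;> simp
  add_zero p := by ext1 <;> simp
  neg_add_cancel p := by ext1 <;> simp
  add_comm p q := by ext1 <;> simp [add_comm]
  nsmul := nsmulRec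
  zsmul := zsmulRec

instance : Module K (Mag K n) where
  one_smul p := by ext1 <;> simp
  mul_smul c d p := by ext1 <;> simp [mul_smul]
  smul_zero c := by ext1 <;> simp
  smul_add c p q := by ext1 <;> simp
  add_smul c d p := by ext1 <;> simp [add_smul]
  zero_smul p := by ext1 <;> simp

/-- The embedding of `Yₙ` into `U = K[y₁,…,yₙ]`. -/
def iota (a : Fin n → K) : MvPolynomial (Fin n) K :=
  ∑ i, MvPolynomial.C (a i) * MvPolynomial.X i

@[simp] lemma iota_zero : iota (0 : Fin n → K) = 0 := by simp [iota]

lemma iota_add (a b : Fin n → K) : iota (a + b) = iota a + iota b := by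
  simp [iota, add_mul, Finset.sum_add_distrib]

lemma iota_smul (c : K) (a : Fin n → K) : iota (c • a) = MvPolynomial.C c * iota a := by
  simp [iota, Finset.mul_sum, mul_assoc]

instance : Bracket (Mag K n) (Mag K n) :=
  ⟨fun p q => ⟨0, fun i => p.t i * iota q.y - q.t i * iota p.y⟩⟩

@[simp] lemma lie_y (p q : Mag K n) : (⁅p, q⁆ : Mag K n).y = 0 := rfl
@[simp] lemma lie_t (p q : Mag K n) :
    (⁅p, q⁆ : Mag K n).t = fun i => p.t i * iota q.y - q.t i * iota p.y := rfl

instance : LieRing (Mag K n) where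
  add_lie p q r := by ext1 <;> [simp; (funext i; simp [iota_add]; ring)]
  lie_add p q r := by ext1 <;> [simp; (funext i; simp [iota_add]; ring)]
  lie_self p := by ext1 <;> [simp; (funext i; simp)]
  leibniz_lie p q r := by ext1 <;> [simp; (funext i; simp; ring)]

instance : LieAlgebra K (Mag K n) where
  lie_smul c p q := by
    ext1 <;> [simp; (funext i; simp [iota_smul, MvPolynomial.smul_eq_C_mul]; ring)]

end Mag

/-- The free generators `xᵢ = yᵢ + tᵢ` of the free metabelian Lie algebra inside the
Magnus model. -/
def xm (K : Type) [Field K] (n : ℕ) (i : Fin n) : Mag K n :=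
  ⟨Pi.single i 1, Pi.single i 1⟩

/-- The free metabelian Lie algebra `Mₙ`, realized as the Lie subalgebra of the Magnus
model generated by `x₁, …, xₙ`. -/
def MagMn (K : Type) [Field K] (n : ℕ) : LieSubalgebra K (Mag K n) :=
  LieSubalgebra.lieSpan K (Mag K n) (Set.range (xm K n))

end

section Koszul

open MvPolynomial

variable {R σ : Type*} [CommRing R]

lemma mem_span_X_of_X_mul_mem {s : Set σ} {k : σ} (hk : k ∉ s) {p : MvPolynomial σ R}
    (h : X k * p ∈ Ideal.span (X '' s : Set (MvPolynomial σ R))) :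
    p ∈ Ideal.span (X '' s : Set (MvPolynomial σ R)) := by
  rw [mem_ideal_span_X_image] at h ⊢
  intro m hm
  obtain ⟨i, hi, hne⟩ := h (Finsupp.single k 1 + m) (by
    rwa [mem_support_iff, coeff_X_mul, ← mem_support_iff])
  have hki : k ≠ i := fun e => hk (e ▸ hi)
  exact ⟨i, hi, by simpa [Finsupp.single_apply, hki] using hne⟩

variable [LinearOrder σ]

/-- The submodule spanned by the Koszul relations `eᵢ Xⱼ - eⱼ Xᵢ`, `i < j`. -/
noncomputable def koszulSpan (R σ : Type*) [CommRing R] [LinearOrder σ] :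
    Submodule (MvPolynomial σ R) (σ → MvPolynomial σ R) :=
  Submodule.span (MvPolynomial σ R)
    {v | ∃ i j : σ, i < j ∧ v = Pi.single i (X j) - Pi.single j (X i)}

lemma single_sub_single_mem_koszulSpan (i j : σ) :
    (Pi.single i (X j) - Pi.single j (X i) : σ → MvPolynomial σ R) ∈ koszulSpan R σ := by
  rcases lt_trichotomy i j with h | rfl | h
  · exact Submodule.subset_span ⟨i, j, h, rfl⟩
  · simp
  · rw [← neg_sub]
    exact neg_mem (Submodule.subset_span ⟨j, i, h, rfl⟩)

lemma mem_koszulSpan_of_sum_X_mul_eq_zero (s : Finset σ) (a : σ → MvPolynomial σ R)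
    (hs : ∀ i ∉ s, a i = 0) (ha : ∑ i ∈ s, X i * a i = 0) : a ∈ koszulSpan R σ := by
  induction s using Finset.induction_on generalizing a with
  | empty =>
    rw [show a = 0 from funext fun i => hs i (by simp)]
    exact zero_mem _
  | insert k s hk ih =>
    rw [Finset.sum_insert hk] at ha
    have hmem : a k ∈ Ideal.span (X '' (s : Set σ) : Set (MvPolynomial σ R)) := by
      refine mem_span_X_of_X_mul_mem (k := k) (by simpa using hk) ?_
      rw [eq_neg_of_add_eq_zero_left ha]
      exact neg_mem (sum_mem fun i hi => Ideal.mul_mem_right _ _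
        (Ideal.subset_span ⟨i, hi, rfl⟩))
    obtain ⟨b, hb⟩ := (Submodule.mem_span_image_finset_iff_exists_fun' _).1 hmem
    simp only [smul_eq_mul] at hb
    set c : σ → MvPolynomial σ R :=
      ∑ i ∈ s, b i • (Pi.single k (X i) - Pi.single i (X k)) with hc
    have hcmem : c ∈ koszulSpan R σ := sum_mem fun i _ =>
      Submodule.smul_mem _ _ (single_sub_single_mem_koszulSpan k i)
    have hck : c k = a k := by
      rw [hc, ← hb, Finset.sum_apply]
      refine Finset.sum_congr rfl fun i hi => ?_
      have : k ≠ i := fun e => hk (e ▸ hi)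
      simp [this]
    have hcs : ∀ i ∈ s, c i = -(b i * X k) := by
      intro i hi
      have hik : i ≠ k := fun e => hk (e ▸ hi)
      rw [hc, Finset.sum_apply, Finset.sum_eq_single i]
      · simp [hik]
      · intro j _ hj
        simp [hik, hj.symm]
      · exact fun h => absurd hi h
    have hco : ∀ i ∉ insert k s, c i = 0 := by
      intro i hi
      rw [Finset.mem_insert, not_or] at hi
      rw [hc, Finset.sum_apply]
      refine Finset.sum_eq_zero fun j hj => ?_
      have : i ≠ j := fun e => hi.2 (e ▸ hj)
      simp [hi.1, this]
    have key : a - c ∈ koszulSpan R σ := by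
      refine ih _ (fun i hi => ?_) ?_
      · by_cases hik : i = k
        · simp [hik, hck]
        · have hi' : i ∉ insert k s := by simp [hik, hi]
          simp [hs i hi', hco i hi']
      · have hsum : ∑ i ∈ s, X i * c i = -(X k * a k) := by
          rw [← hb, Finset.mul_sum, ← Finset.sum_neg_distrib]
          refine Finset.sum_congr rfl fun i hi => ?_
          rw [hcs i hi]
          ring
        simp only [Pi.sub_apply, mul_sub, Finset.sum_sub_distrib, hsum]
        rw [← ha]
        ring
    simpa using add_mem key hcmem

/-- Exactness of the Koszul complex of the variables in degree one. -/
theorem mem_koszulSpan_iff [Fintype σ] {a : σ → MvPolynomial σ R} :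
    a ∈ koszulSpan R σ ↔ ∑ i, X i * a i = 0 := by
  refine ⟨fun h => ?_, fun h => mem_koszulSpan_of_sum_X_mul_eq_zero Finset.univ a (by simp) h⟩
  induction h using Submodule.span_induction with
  | mem v hv =>
    obtain ⟨i, j, -, rfl⟩ := hv
    simp [mul_sub, Finset.sum_sub_distrib, Pi.single_apply, mul_comm]
  | zero => simp
  | add v w _ _ hv hw => simp [mul_add, Finset.sum_add_distrib, hv, hw]
  | smul p v _ hv => simp [mul_left_comm, ← Finset.mul_sum, hv]

end Koszul

section Commutator

open MvPolynomial

variable {K : Type} [Field K] {n : ℕ}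

/-- The Fox derivatives as a linear map. -/
noncomputable def Mag.foxLinear (K : Type) [Field K] (n : ℕ) :
    Mag K n →ₗ[K] (Fin n → MvPolynomial (Fin n) K) where
  toFun := Mag.t
  map_add' := Mag.add_t
  map_smul' := Mag.smul_t

@[simp] lemma Mag.iota_single (i : Fin n) : Mag.iota (Pi.single i (1 : K)) = X i := by
  simp [Mag.iota, Pi.single_apply]

/-- The commutator `[Mₙ, Mₙ]` as a subspace of the Magnus model. -/
noncomputable def MagMn.commutator (K : Type) [Field K] (n : ℕ) : Submodule K (Mag K n) :=
  Submodule.span K {z | ∃ u ∈ MagMn K n, ∃ v ∈ MagMn K n, z = ⁅u, v⁆}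

lemma xm_mem_MagMn (i : Fin n) : xm K n i ∈ MagMn K n :=
  LieSubalgebra.subset_lieSpan ⟨i, rfl⟩

/-- The fundamental identity of the Fox derivatives on `Mₙ`. -/
lemma MagMn.sum_X_mul_t {f : Mag K n} (hf : f ∈ MagMn K n) :
    ∑ i, X i * f.t i = Mag.iota f.y := by
  induction hf using LieSubalgebra.lieSpan_induction with
  | mem f hf =>
    obtain ⟨i, rfl⟩ := hf
    simp [xm, Pi.single_apply]
  | zero => simp
  | add f g _ _ hf hg => simp [mul_add, Finset.sum_add_distrib, hf, hg, Mag.iota_add]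
  | smul c f _ hf =>
    simp [Mag.iota_smul, ← hf, Finset.mul_sum, smul_eq_C_mul, mul_left_comm]
  | lie f g _ _ hf hg =>
    simp only [Mag.lie_t, Mag.lie_y, Mag.iota_zero, mul_sub, ← mul_assoc,
      Finset.sum_sub_distrib, ← Finset.sum_mul, hf, hg]
    ring

lemma MagMn.commutator_le : MagMn.commutator K n ≤ (MagMn K n).toSubmodule := by
  refine Submodule.span_le.2 ?_
  rintro _ ⟨u, hu, v, hv, rfl⟩
  exact (MagMn K n).lie_mem hu hv

lemma MagMn.y_eq_zero_of_mem_commutator {f : Mag K n} (hf : f ∈ MagMn.commutator K n) :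
    f.y = 0 := by
  induction hf using Submodule.span_induction with
  | mem f hf =>
    obtain ⟨u, -, v, -, rfl⟩ := hf
    rfl
  | zero => rfl
  | add f g _ _ hf hg => simp [hf, hg]
  | smul c f _ hf => simp [hf]

lemma MagMn.smul_mem_map_commutator (p : MvPolynomial (Fin n) K)
    {a : Fin n → MvPolynomial (Fin n) K}
    (ha : a ∈ (MagMn.commutator K n).map (Mag.foxLinear K n)) :
    p • a ∈ (MagMn.commutator K n).map (Mag.foxLinear K n) := by
  induction p using MvPolynomial.induction_on with
  | C c =>
    convert Submodule.smul_mem _ c ha using 1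
    ext1 i
    simp [smul_eq_C_mul]
  | add p q hp hq =>
    rw [add_smul]
    exact add_mem hp hq
  | mul_X p k hp =>
    obtain ⟨f, hf, hfa⟩ := hp
    refine ⟨⁅f, xm K n k⁆, Submodule.subset_span
      ⟨f, MagMn.commutator_le hf, _, xm_mem_MagMn k, rfl⟩, ?_⟩
    rw [mul_comm, mul_smul, ← hfa]
    ext1 i
    simp [Mag.foxLinear, xm, MagMn.y_eq_zero_of_mem_commutator hf, mul_comm]

lemma koszulSpan_le_map_commutator {a : Fin n → MvPolynomial (Fin n) K}
    (ha : a ∈ koszulSpan K (Fin n)) :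
    a ∈ (MagMn.commutator K n).map (Mag.foxLinear K n) := by
  induction ha using Submodule.span_induction with
  | mem v hv =>
    obtain ⟨i, j, -, rfl⟩ := hv
    refine ⟨⁅xm K n i, xm K n j⁆, Submodule.subset_span
      ⟨_, xm_mem_MagMn i, _, xm_mem_MagMn j, rfl⟩, ?_⟩
    ext1 k
    simp [Mag.foxLinear, xm, Pi.single_apply]
  | zero => exact zero_mem _
  | add v w _ _ hv hw => exact add_mem hv hw
  | smul p v _ hv => exact MagMn.smul_mem_map_commutator p hv

end Commutator

open MvPolynomial in
/-- **Lemma 1.** For a column `a = (a₁,…,aₙ)ᵗ` over `U = K[y₁,…,yₙ]`, the following are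
equivalent: (a) `a = ∂f` for some `f ∈ [Mₙ,Mₙ]`; (b) `y₁a₁ + ⋯ + yₙaₙ = 0`;
(c) `a = ∑_{i<j} (eᵢyⱼ - eⱼyᵢ)a_{ij}` for some `a_{ij} ∈ U`. -/
theorem fox_derivative_tfae (K : Type) [Field K] (n : ℕ) (hn : 2 ≤ n)
    (a : Fin n → MvPolynomial (Fin n) K) :
    ((∃ f ∈ Submodule.span K
        {z : Mag K n | ∃ u ∈ MagMn K n, ∃ v ∈ MagMn K n, z = ⁅u, v⁆},
        Mag.t f = a) ↔ (∑ i, X i * a i) = 0)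
    ∧ ((∑ i, X i * a i) = 0 ↔
        a ∈ Submodule.span (MvPolynomial (Fin n) K)
          {v : Fin n → MvPolynomial (Fin n) K |
            ∃ i j : Fin n, i < j ∧ v = Pi.single i (X j) - Pi.single j (X i)}) := by
  refine ⟨⟨?_, fun h => koszulSpan_le_map_commutator (mem_koszulSpan_iff.2 h)⟩,
    mem_koszulSpan_iff.symm⟩
  rintro ⟨f, hf, rfl⟩
  rw [MagMn.sum_X_mul_t (MagMn.commutator_le hf), MagMn.y_eq_zero_of_mem_commutator hf,
    Mag.iota_zero]
end

section
/- Let $K$ be a field and $n\geq 2$. An endomorphism $\phi$ of the free metabelian Lie algebra $M_n$ is an automorphism if and only if its Jacobian matrix $J(\phi)$ is an invertible matrix over $U=K[y_1,\ldots,y_n]$. -/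
namespace Mag

variable {K : Type} [Field K] {n : ℕ}

lemma iota_single_s10 (j : Fin n) : iota (Pi.single j 1 : Fin n → K) = MvPolynomial.X j := by
  rw [iota, Finset.sum_eq_single j] <;> simp +contextual

lemma constantCoeff_iota (a : Fin n → K) : MvPolynomial.constantCoeff (iota a) = 0 := by
  simp [iota]

/-- Substituting `Xⱼ ↦ iota (A eⱼ)` turns `iota a` into `iota (A a)`. -/
lemma aeval_iota (A : Matrix (Fin n) (Fin n) K) (a : Fin n → K) :
    MvPolynomial.aeval (fun j => iota (A.col j)) (iota a) = iota (A.mulVec a) := by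
  simp only [iota, map_sum, map_mul, MvPolynomial.aeval_X, MvPolynomial.algHom_C,
    MvPolynomial.algebraMap_eq, Matrix.mulVec, dotProduct, Finset.mul_sum, Finset.sum_mul,
    Matrix.col_apply]
  rw [Finset.sum_comm]
  refine Finset.sum_congr rfl fun i _ => Finset.sum_congr rfl fun j _ => ?_
  ring

lemma aeval_iota_aeval_iota {A B : Matrix (Fin n) (Fin n) K} (h : A * B = 1)
    (u : MvPolynomial (Fin n) K) :
    MvPolynomial.aeval (fun j => iota (A.col j))
      (MvPolynomial.aeval (fun j => iota (B.col j)) u) = u := by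
  have : (MvPolynomial.aeval (fun j => iota (A.col j))).comp
      (MvPolynomial.aeval (fun j => iota (B.col j))) =
      AlgHom.id K (MvPolynomial (Fin n) K) := by
    ext1 j
    have hB : B.col j = B.mulVec (Pi.single j 1) := by simp
    rw [AlgHom.comp_apply, MvPolynomial.aeval_X, aeval_iota, hB, Matrix.mulVec_mulVec, h,
      Matrix.one_mulVec, iota_single_s10, AlgHom.id_apply]
  exact DFunLike.congr_fun this u

/-- `X a` is a non-zero-divisor modulo the ideal generated by the variables in `s`,
when `a ∉ s`. -/
lemma mem_span_X_of_mul_X_mem {s : Set (Fin n)} {a : Fin n} (ha : a ∉ s)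
    {u : MvPolynomial (Fin n) K}
    (h : u * MvPolynomial.X a ∈ Ideal.span (MvPolynomial.X '' s)) :
    u ∈ Ideal.span (MvPolynomial.X '' s : Set (MvPolynomial (Fin n) K)) := by
  rw [MvPolynomial.mem_ideal_span_X_image] at h ⊢
  intro m hm
  obtain ⟨i, hi, hmi⟩ := h (m + Finsupp.single a 1) (by
    rw [MvPolynomial.mem_support_iff, MvPolynomial.coeff_mul_X]
    exact MvPolynomial.mem_support_iff.mp hm)
  have hia : a ≠ i := fun e => ha (e ▸ hi)
  exact ⟨i, hi, by simpa [Finsupp.single_apply, hia] using hmi⟩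

lemma xm_mem (i : Fin n) : xm K n i ∈ MagMn K n :=
  LieSubalgebra.subset_lieSpan (Set.mem_range_self i)

lemma smul_t_mem (u : MvPolynomial (Fin n) K) :
    ∀ t : Fin n → MvPolynomial (Fin n) K,
      (⟨0, t⟩ : Mag K n) ∈ MagMn K n → (⟨0, u • t⟩ : Mag K n) ∈ MagMn K n := by
  induction u using MvPolynomial.induction_on with
  | C c =>
    intro t ht
    convert (MagMn K n).smul_mem c ht using 1
    ext1
    · simp
    · funext i; simp [MvPolynomial.smul_eq_C_mul]
  | add u v hu hv =>
    intro t ht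
    convert (MagMn K n).add_mem (hu t ht) (hv t ht) using 1
    ext1
    · simp
    · simp [add_smul]
  | mul_X u k hu =>
    intro t ht
    convert (MagMn K n).lie_mem (hu t ht) (xm_mem k) using 1
    ext1
    · simp
    · funext i; simp [xm, iota_single_s10]; ring

/-- Exactness of the Koszul complex in degree one: every syzygy of the variables, regarded as
an element of `Tₙ`, lies in the free metabelian Lie algebra. -/
lemma mem_of_sum_mul_X_eq_zero (s : Finset (Fin n)) :
    ∀ t : Fin n → MvPolynomial (Fin n) K, (∀ i ∉ s, t i = 0) →
      ∑ i, t i * MvPolynomial.X i = 0 → (⟨0, t⟩ : Mag K n) ∈ MagMn K n := by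
  induction s using Finset.induction_on with
  | empty =>
    intro t ht _
    have : t = 0 := funext fun i => ht i (by simp)
    subst this
    exact (MagMn K n).zero_mem
  | insert a s ha ih =>
    intro t ht hsum
    have hsum' : t a * MvPolynomial.X a + ∑ i ∈ s, t i * MvPolynomial.X i = 0 := by
      rw [← Finset.sum_insert (f := fun i => t i * MvPolynomial.X i) ha, ← hsum]
      refine Finset.sum_subset (Finset.subset_univ _) fun i _ hi => ?_
      rw [ht i hi, zero_mul]
    have hmem : t a ∈ Ideal.span
        (MvPolynomial.X '' (s : Set (Fin n)) : Set (MvPolynomial (Fin n) K)) := by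
      refine mem_span_X_of_mul_X_mem (by simpa using ha) ?_
      rw [eq_neg_of_add_eq_zero_left hsum']
      refine neg_mem (sum_mem fun i hi => Ideal.mul_mem_left _ _ (Ideal.subset_span ?_))
      exact ⟨i, by simpa using hi, rfl⟩
    obtain ⟨c, hc⟩ := (Submodule.mem_span_image_finset_iff_exists_fun' _).mp hmem
    let w : Fin n → MvPolynomial (Fin n) K :=
      ∑ i ∈ s, c i • (⁅xm K n a, xm K n i⁆ : Mag K n).t
    have hlie : ∀ i, ∑ k, (⁅xm K n a, xm K n i⁆ : Mag K n).t k * MvPolynomial.X k = 0 := by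
      intro i
      simp only [lie_t, xm, iota_single_s10, sub_mul, Pi.single_apply, Finset.sum_sub_distrib,
        ite_mul, one_mul, zero_mul, Finset.sum_ite_eq', Finset.mem_univ, if_true]
      ring
    have hw : (⟨0, w⟩ : Mag K n) ∈ MagMn K n := by
      have key : ∀ s' : Finset (Fin n), (⟨0, ∑ i ∈ s', c i •
          (⁅xm K n a, xm K n i⁆ : Mag K n).t⟩ : Mag K n) ∈ MagMn K n := by
        intro s'
        induction s' using Finset.induction_on with
        | empty => exact (MagMn K n).zero_mem
        | insert b s' hb ih' =>
          rw [Finset.sum_insert hb]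
          convert (MagMn K n).add_mem (smul_t_mem (c b) _
            ((MagMn K n).lie_mem (xm_mem a) (xm_mem b))) ih' using 1
          ext1 <;> simp
      exact key s
    have hd : (⟨0, t - w⟩ : Mag K n) ∈ MagMn K n := by
      refine ih _ ?_ ?_
      · intro i hi
        by_cases hia : i = a
        · subst hia
          have : ∀ j ∈ s, c j * (⁅xm K n i, xm K n j⁆ : Mag K n).t i =
              c j • MvPolynomial.X j := by
            intro j hj
            have hij : i ≠ j := fun e => ha (e ▸ hj)
            simp [xm, iota_single_s10, hij]
          simp only [w, Pi.sub_apply, Finset.sum_apply, Pi.smul_apply, smul_eq_mul]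
          rw [Finset.sum_congr rfl this, hc, sub_self]
        · have : ∀ j ∈ s, c j * (⁅xm K n a, xm K n j⁆ : Mag K n).t i = 0 := by
            intro j hj
            have hij : i ≠ j := fun e => hi (e ▸ hj)
            simp [xm, hij, hia]
          simp only [w, Pi.sub_apply, Finset.sum_apply, Pi.smul_apply, smul_eq_mul]
          rw [Finset.sum_eq_zero this, ht i (by simp [hi, hia]), sub_self]
      · have : ∑ k, w k * MvPolynomial.X k = 0 := by
          simp only [w, Finset.sum_apply, Pi.smul_apply, smul_eq_mul, Finset.sum_mul]
          rw [Finset.sum_comm]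
          refine Finset.sum_eq_zero fun i _ => ?_
          simp only [mul_assoc, ← Finset.mul_sum, hlie, mul_zero]
        simp only [Pi.sub_apply, sub_mul, Finset.sum_sub_distrib, hsum, this, sub_self]
    convert (MagMn K n).add_mem hd hw using 1
    ext1 <;> simp

/-- The free metabelian Lie algebra is cut out of the Magnus model by the fundamental formula
of Fox calculus, `∑ᵢ (∂f/∂xᵢ) yᵢ = y`. -/
lemma mem_MagMn_iff (p : Mag K n) :
    p ∈ MagMn K n ↔ ∑ i, p.t i * MvPolynomial.X i = iota p.y := by
  constructor
  · intro hp
    induction hp using LieSubalgebra.lieSpan_induction with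
    | mem x h =>
      obtain ⟨j, rfl⟩ := h
      simp [xm, iota_single_s10, Pi.single_apply]
    | zero => simp
    | add x y _ _ hx hy => simp [add_mul, Finset.sum_add_distrib, hx, hy, iota_add]
    | smul c x _ hx =>
      simp [iota_smul, MvPolynomial.smul_eq_C_mul, mul_assoc, ← Finset.mul_sum, hx]
    | lie x y _ _ hx hy =>
      have : ∀ i, (x.t i * iota y.y - y.t i * iota x.y) * MvPolynomial.X i =
          iota y.y * (x.t i * MvPolynomial.X i) - iota x.y * (y.t i * MvPolynomial.X i) :=
        fun i => by ring
      simp only [lie_t, lie_y, iota_zero, this, Finset.sum_sub_distrib, ← Finset.mul_sum, hx, hy]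
      ring
  · intro hp
    have hC : (⟨p.y, fun i => MvPolynomial.C (p.y i)⟩ : Mag K n) ∈ MagMn K n := by
      let yLin : Mag K n →ₗ[K] (Fin n → K) := ⟨⟨Mag.y, add_y⟩, smul_y⟩
      let tLin : Mag K n →ₗ[K] (Fin n → MvPolynomial (Fin n) K) := ⟨⟨Mag.t, add_t⟩, smul_t⟩
      have hs : ∑ i, p.y i • xm K n i ∈ MagMn K n :=
        sum_mem fun i _ => (MagMn K n).smul_mem (p.y i) (xm_mem i)
      convert hs using 1
      ext1
      · change p.y = yLin _
        rw [map_sum]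
        funext i
        simp [yLin, xm, Finset.sum_apply, Pi.single_apply]
      · change _ = tLin _
        rw [map_sum]
        funext i
        simp [tLin, xm, Finset.sum_apply, Pi.single_apply, MvPolynomial.smul_eq_C_mul]
    have h0 : (⟨0, p.t - fun i => MvPolynomial.C (p.y i)⟩ : Mag K n) ∈ MagMn K n := by
      refine mem_of_sum_mul_X_eq_zero Finset.univ _ (by simp) ?_
      simp only [Pi.sub_apply, sub_mul, Finset.sum_sub_distrib, hp]
      exact sub_self _
    convert (MagMn K n).add_mem h0 hC using 1
    ext1 <;> simp

lemma constantCoeff_t_of_mem {p : Mag K n} (hp : p ∈ MagMn K n) (i : Fin n) :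
    MvPolynomial.constantCoeff (p.t i) = p.y i := by
  induction hp using LieSubalgebra.lieSpan_induction with
  | mem x h =>
    obtain ⟨j, rfl⟩ := h
    by_cases h : i = j <;> simp [xm, h]
  | zero => simp
  | add x y _ _ hx hy => simp [hx, hy]
  | smul c x _ hx => simp [MvPolynomial.smul_eq_C_mul, hx]
  | lie x y _ _ hx hy => simp [constantCoeff_iota]

/-- The matrix of the linear part of an endomorphism. -/
noncomputable def linMat (φ : MagMn K n →ₗ⁅K⁆ MagMn K n) : Matrix (Fin n) (Fin n) K :=
  Matrix.of fun i j => (φ ⟨xm K n j, xm_mem j⟩).val.y i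

/-- The Jacobian matrix of an endomorphism. -/
noncomputable def jacobian (φ : MagMn K n →ₗ⁅K⁆ MagMn K n) :
    Matrix (Fin n) (Fin n) (MvPolynomial (Fin n) K) :=
  Matrix.of fun i j => (φ ⟨xm K n j, xm_mem j⟩).val.t i

lemma constantCoeff_map_jacobian (φ : MagMn K n →ₗ⁅K⁆ MagMn K n) :
    MvPolynomial.constantCoeff.mapMatrix (jacobian φ) = linMat φ := by
  ext i j
  simpa [jacobian, linMat] using constantCoeff_t_of_mem (φ ⟨xm K n j, xm_mem j⟩).2 i

/-- The chain rule. -/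
lemma endo_apply (φ : MagMn K n →ₗ⁅K⁆ MagMn K n) {p : Mag K n} (hp : p ∈ MagMn K n) :
    (φ ⟨p, hp⟩).val = ⟨(linMat φ).mulVec p.y, (jacobian φ).mulVec fun j =>
      MvPolynomial.aeval (fun k => iota ((linMat φ).col k)) (p.t j)⟩ := by
  induction hp using LieSubalgebra.lieSpan_induction with
  | mem x h =>
    obtain ⟨j, rfl⟩ := h
    ext1
    · funext i; simp [xm, linMat]
    · have : (fun i => MvPolynomial.aeval (fun k => iota ((linMat φ).col k)) ((xm K n j).t i)) =
          Pi.single j 1 := by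
        funext i
        by_cases h : i = j <;> simp [xm, h]
      simp only [this]
      funext i
      simp [jacobian]
  | zero =>
    have : (⟨0, (MagMn K n).zero_mem⟩ : MagMn K n) = 0 := rfl
    rw [this, map_zero]
    ext1
    · simp
    · funext i; simp [Matrix.mulVec, dotProduct]
  | add x y hx' hy' hx hy =>
    have : (⟨x + y, (MagMn K n).add_mem hx' hy'⟩ : MagMn K n) = ⟨x, hx'⟩ + ⟨y, hy'⟩ := rfl
    rw [this, map_add, AddMemClass.coe_add, hx, hy]
    ext1
    · simp [Matrix.mulVec_add]
    · funext i; simp [Matrix.mulVec, dotProduct, mul_add, Finset.sum_add_distrib]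
  | smul c x hx' hx =>
    have : (⟨c • x, (MagMn K n).smul_mem c hx'⟩ : MagMn K n) = c • ⟨x, hx'⟩ := rfl
    rw [this, map_smul, SetLike.val_smul, hx]
    ext1
    · simp [Matrix.mulVec_smul]
    · funext i; simp [Matrix.mulVec, dotProduct, Finset.smul_sum]
  | lie x y hx' hy' hx hy =>
    have : (⟨⁅x, y⁆, (MagMn K n).lie_mem hx' hy'⟩ : MagMn K n) =
        ⁅(⟨x, hx'⟩ : MagMn K n), (⟨y, hy'⟩ : MagMn K n)⁆ := rfl
    rw [this, LieHom.map_lie, LieSubalgebra.coe_bracket, hx, hy]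
    ext1
    · simp
    · funext i
      simp only [lie_t, map_sub, map_mul, aeval_iota, Matrix.mulVec, dotProduct, mul_sub,
        Finset.sum_sub_distrib, Finset.sum_mul, mul_assoc]

lemma isUnit_jacobian_of_surjective (φ : MagMn K n →ₗ⁅K⁆ MagMn K n)
    (h : Function.Surjective φ) : IsUnit (jacobian φ) := by
  choose g hg using fun j : Fin n => h ⟨xm K n j, xm_mem j⟩
  refine IsUnit.of_mul_eq_one (Matrix.of fun i j =>
    MvPolynomial.aeval (fun k => iota ((linMat φ).col k)) ((g j).val.t i)) ?_
  ext1 i j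
  have := congrFun (congrArg (fun p => p.val.t) (hg j)) i
  have e := endo_apply φ (g j).2
  simp only [Subtype.coe_eta] at e
  simp only [e] at this
  rw [Matrix.mul_apply, Matrix.one_apply]
  simpa [Matrix.mulVec, dotProduct, xm, Pi.single_apply] using this

lemma bijective_of_isUnit_jacobian (φ : MagMn K n →ₗ⁅K⁆ MagMn K n)
    (h : IsUnit (jacobian φ)) : Function.Bijective φ := by
  have hA : IsUnit (linMat φ) := constantCoeff_map_jacobian φ ▸ h.map _
  obtain ⟨B, hAB, hBA⟩ := isUnit_iff_exists.mp hA
  obtain ⟨J, hJ, hJ'⟩ := isUnit_iff_exists.mp h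
  constructor
  · rintro ⟨p, hp⟩ ⟨q, hq⟩ hpq
    have e := congrArg Subtype.val hpq
    rw [endo_apply, endo_apply] at e
    have ey := congrArg (fun r => B.mulVec r.y) e
    have et := congrArg (fun r => J.mulVec r.t) e
    simp only [Matrix.mulVec_mulVec, hBA, hJ', Matrix.one_mulVec] at ey et
    refine Subtype.ext (Mag.ext' ey (funext fun i => ?_))
    rw [← aeval_iota_aeval_iota hBA (p.t i), congrFun et i, aeval_iota_aeval_iota hBA]
  · rintro ⟨p, hp⟩
    let q : Mag K n := ⟨B.mulVec p.y, fun i =>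
      MvPolynomial.aeval (fun k => iota (B.col k)) (J.mulVec p.t i)⟩
    have ht : (jacobian φ).mulVec (fun j =>
        MvPolynomial.aeval (fun k => iota ((linMat φ).col k)) (q.t j)) = p.t := by
      simp only [q, aeval_iota_aeval_iota hAB]
      change (jacobian φ).mulVec (J.mulVec p.t) = p.t
      rw [Matrix.mulVec_mulVec, hJ, Matrix.one_mulVec]
    have hy : (linMat φ).mulVec q.y = p.y := by
      simp only [q, Matrix.mulVec_mulVec, hAB, Matrix.one_mulVec]
    have hcol : ∀ j, ∑ i, jacobian φ i j * MvPolynomial.X i = iota ((linMat φ).col j) :=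
      fun j => (mem_MagMn_iff _).mp (φ ⟨xm K n j, xm_mem j⟩).2
    have hq : q ∈ MagMn K n := by
      rw [mem_MagMn_iff] at hp ⊢
      rw [← hy, ← aeval_iota, ← ht] at hp
      rw [← aeval_iota_aeval_iota hBA (∑ i, q.t i * MvPolynomial.X i),
        ← aeval_iota_aeval_iota hBA (iota q.y), ← hp]
      congr 1
      simp only [map_sum, map_mul, MvPolynomial.aeval_X, ← hcol, Matrix.mulVec, dotProduct,
        Finset.sum_mul, Finset.mul_sum]
      rw [Finset.sum_comm]
      refine Finset.sum_congr rfl fun i _ => Finset.sum_congr rfl fun j _ => ?_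
      ring
    refine ⟨⟨q, hq⟩, Subtype.ext ?_⟩
    rw [endo_apply, hy, ht]

end Mag

/-- **Lemma 2.** An endomorphism `φ` of the free metabelian Lie algebra `Mₙ` is an
automorphism if and only if its Jacobian matrix `J(φ) = [∂fⱼ/∂xᵢ]` (where `fⱼ = φ(xⱼ)`)
is an invertible matrix over `U = K[y₁,…,yₙ]`. -/
theorem endo_is_aut_iff_jacobian_isUnit (K : Type) [Field K] (n : ℕ) (hn : 2 ≤ n)
    (φ : ↥(MagMn K n) →ₗ⁅K⁆ ↥(MagMn K n)) :
    Function.Bijective φ ↔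
      IsUnit (Matrix.of fun i j : Fin n =>
        (φ ⟨xm K n j, LieSubalgebra.subset_lieSpan (Set.mem_range_self j)⟩).val.t i) := by
  exact ⟨fun h => Mag.isUnit_jacobian_of_surjective φ h.surjective,
    Mag.bijective_of_isUnit_jacobian φ⟩
end
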